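/- arXiv:1509.09188 — 2 statements merged into one kernel-verified Lean document; each statement's English description precedes it below -/
import Mathlib

section
/- If Ψ ≥ 10^4·k^3/ε^2 for some ε ∈ (0,1), then for all distinct i,j ∈ {1,…,k} the rows of the matrix B satisfy |⟨B_{i,:}, B_{j,:}⟩| ≤ √ε. -/
open Finset BigOperators Matrix

namespace SpectralClustering

variable {V : Type} [Fintype V] [DecidableEq V]

/-- Volume of a vertex set: the sum of the degrees of its vertices. -/
def vol (G : SimpleGraph V) [DecidableRel G.Adj] (S : Finset V) : ℕ :=
  ∑ v ∈ S, G.degree v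

/-- Number of edges between two (disjoint) vertex sets. -/
def cut (G : SimpleGraph V) [DecidableRel G.Adj] (S T : Finset V) : ℕ :=
  ∑ u ∈ S, (T.filter fun v => G.Adj u v).card

/-- Conductance `φ(S) = |E(S, V \ S)| / μ(S)`. -/
noncomputable def conductance (G : SimpleGraph V) [DecidableRel G.Adj] (S : Finset V) : ℝ :=
  (cut G S Sᶜ : ℝ) / (vol G S : ℝ)

/-- A `k`-way partition of the vertex set into nonempty blocks. -/
def IsKWayPartition {k : ℕ} (P : Fin k → Finset V) : Prop :=
  (∀ i, (P i).Nonempty) ∧ (∀ i j, i ≠ j → Disjoint (P i) (P j)) ∧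
    (∀ v : V, ∃ i, v ∈ P i)

/-- Maximum conductance over the blocks of a tuple of sets. -/
noncomputable def maxCond (G : SimpleGraph V) [DecidableRel G.Adj] {k : ℕ}
    (P : Fin k → Finset V) : ℝ :=
  ⨆ i, conductance G (P i)

/-- Average conductance of the blocks. -/
noncomputable def avgCond (G : SimpleGraph V) [DecidableRel G.Adj] {k : ℕ}
    (P : Fin k → Finset V) : ℝ :=
  (∑ i, conductance G (P i)) / (k : ℝ)

/-- `P` achieves `ρ̂_avr(k)`: it minimizes the maximum conductance among all
`k`-way partitions, and among those it has minimal average conductance. -/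
def AchievesRhoAvr (G : SimpleGraph V) [DecidableRel G.Adj] {k : ℕ}
    (P : Fin k → Finset V) : Prop :=
  IsKWayPartition P ∧
  (∀ Q : Fin k → Finset V, IsKWayPartition Q → maxCond G P ≤ maxCond G Q) ∧
  (∀ Q : Fin k → Finset V, IsKWayPartition Q → maxCond G Q = maxCond G P →
    avgCond G P ≤ avgCond G Q)

/-- Dot product of two vectors indexed by the vertices. -/
def dotV (x y : V → ℝ) : ℝ := ∑ v, x v * y v

/-- The normalized Laplacian `I - D^{-1/2} A D^{-1/2}`. -/
noncomputable def normLap (G : SimpleGraph V) [DecidableRel G.Adj] : Matrix V V ℝ :=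
  1 - Matrix.diagonal (fun v => (Real.sqrt (G.degree v))⁻¹) * G.adjMatrix ℝ *
      Matrix.diagonal (fun v => (Real.sqrt (G.degree v))⁻¹)

/-- `f` is an orthonormal family of eigenvectors of the normalized Laplacian of `G`
with (sorted) eigenvalues `lam`. -/
structure EigenData (G : SimpleGraph V) [DecidableRel G.Adj]
    (f : Fin (Fintype.card V) → V → ℝ) (lam : Fin (Fintype.card V) → ℝ) : Prop where
  eig : ∀ i, (normLap G).mulVec (f i) = lam i • f i
  ortho : ∀ i j, dotV (f i) (f j) = if i = j then (1 : ℝ) else 0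
  mono : Monotone lam

/-- The gap parameter `Ψ = λ_{k+1} / ρ̂_avr(k)`, where `ρ̂_avr(k)` is realized as the
average conductance of the fixed optimal partition `P`. -/
noncomputable def Psi (G : SimpleGraph V) [DecidableRel G.Adj]
    (lam : Fin (Fintype.card V) → ℝ) {k : ℕ} (P : Fin k → Finset V)
    (hkn : k < Fintype.card V) : ℝ :=
  lam ⟨k, hkn⟩ / avgCond G P

/-- The spectral embedding `F(u) = d_u^{-1/2} (f_1(u), …, f_k(u))`. -/
noncomputable def Femb (G : SimpleGraph V) [DecidableRel G.Adj]
    (f : Fin (Fintype.card V) → V → ℝ) {k : ℕ} (hk : k ≤ Fintype.card V) (u : V) :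
    Fin k → ℝ :=
  fun j => f (Fin.castLE hk j) u / Real.sqrt (G.degree u)

/-- `k`-means cost of a clustering of the (degree-weighted) spectral embedding:
`∑_i ∑_{u ∈ A_i} d_u ‖F(u) - c_i‖²`. -/
noncomputable def kmCost (G : SimpleGraph V) [DecidableRel G.Adj]
    (f : Fin (Fintype.card V) → V → ℝ) {k : ℕ} (hk : k ≤ Fintype.card V) {ℓ : ℕ}
    (A : Fin ℓ → Finset V) (c : Fin ℓ → Fin k → ℝ) : ℝ :=
  ∑ i, ∑ u ∈ A i, (G.degree u : ℝ) * ∑ j, (Femb G f hk u j - c i j) ^ 2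

/-- `Δ_ℓ(𝒳_V)`: the optimal `ℓ`-means cost of the spectral embedding multiset `𝒳_V`
(which contains `d_u` copies of `F(u)` for every vertex `u`). -/
noncomputable def kmOpt (G : SimpleGraph V) [DecidableRel G.Adj]
    (f : Fin (Fintype.card V) → V → ℝ) {k : ℕ} (hk : k ≤ Fintype.card V) (ℓ : ℕ) : ℝ :=
  sInf { r : ℝ | ∃ (A : Fin ℓ → Finset V) (c : Fin ℓ → Fin k → ℝ),
    (∀ i j, i ≠ j → Disjoint (A i) (A j)) ∧ (∀ v : V, ∃ i, v ∈ A i) ∧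
    r = kmCost G f hk A c }

/-- Normalized characteristic vector `ḡ_i = D^{1/2} χ_{P_i} / √μ(P_i)`. -/
noncomputable def gbar (G : SimpleGraph V) [DecidableRel G.Adj] {k : ℕ}
    (P : Fin k → Finset V) (i : Fin k) : V → ℝ :=
  fun v => (if v ∈ P i then Real.sqrt (G.degree v) else 0) / Real.sqrt (vol G (P i))

/-- Coefficients `α_j^{(i)} = ⟨ḡ_i, f_j⟩` of `ḡ_i` in the eigenbasis. -/
noncomputable def alpha (G : SimpleGraph V) [DecidableRel G.Adj] {k : ℕ}
    (P : Fin k → Finset V) (f : Fin (Fintype.card V) → V → ℝ)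
    (i : Fin k) (j : Fin (Fintype.card V)) : ℝ :=
  dotV (gbar G P i) (f j)

/-- Projection `f̂_i = ∑_{j=1}^k α_j^{(i)} f_j` of `ḡ_i` onto the first `k` eigenvectors. -/
noncomputable def fhat (G : SimpleGraph V) [DecidableRel G.Adj] {k : ℕ}
    (P : Fin k → Finset V) (f : Fin (Fintype.card V) → V → ℝ) (i : Fin k) : V → ℝ :=
  fun v => ∑ j : Fin (Fintype.card V),
    if (j : ℕ) < k then alpha G P f i j * f j v else 0

/-- Estimation center `p^{(i)} = μ(P_i)^{-1/2} (β_i^{(1)}, …, β_i^{(k)})`;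
here `beta i j` denotes `β_j^{(i)}`. -/
noncomputable def estCenter (G : SimpleGraph V) [DecidableRel G.Adj] {k : ℕ}
    (P : Fin k → Finset V) (beta : Fin k → Fin k → ℝ) (i : Fin k) : Fin k → ℝ :=
  fun j => beta j i / Real.sqrt (vol G (P i))

/-- The quadratic form of the normalized Laplacian at `D^{1/2} x` is the Dirichlet energy of `x`. -/
theorem dotV_normLap_mulVec (G : SimpleGraph V) [DecidableRel G.Adj]
    (hd : ∀ v : V, 0 < G.degree v) (x : V → ℝ) :
    dotV (fun v => Real.sqrt (G.degree v) * x v)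
        ((normLap G).mulVec fun v => Real.sqrt (G.degree v) * x v) =
      (∑ u, ∑ v, if G.Adj u v then (x u - x v) ^ 2 else 0) / 2 := by
  rw [← G.lapMatrix_toLinearMap₂' ℝ, Matrix.toLinearMap₂'_apply']
  refine Finset.sum_congr rfl fun v _ => ?_
  have hpos (u : V) : 0 < Real.sqrt (G.degree u) := Real.sqrt_pos.2 (by exact_mod_cast hd u)
  have hinner : (Matrix.diagonal fun v => (Real.sqrt (G.degree v))⁻¹).mulVec
      (fun v => Real.sqrt (G.degree v) * x v) = x := by
    ext u
    rw [Matrix.mulVec_diagonal]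
    field_simp [(hpos u).ne']
  have hsq : (G.degree v : ℝ) = Real.sqrt (G.degree v) * Real.sqrt (G.degree v) :=
    (Real.mul_self_sqrt (Nat.cast_nonneg _)).symm
  rw [G.lapMatrix_mulVec_apply, normLap, Matrix.sub_mulVec, Matrix.one_mulVec,
    ← Matrix.mulVec_mulVec, hinner, ← Matrix.mulVec_mulVec, Pi.sub_apply,
    Matrix.mulVec_diagonal, SimpleGraph.adjMatrix_mulVec_apply]
  have := (hpos v).ne'
  have hcancel : Real.sqrt (G.degree v) * (Real.sqrt (G.degree v))⁻¹ = 1 := mul_inv_cancel₀ this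
  linear_combination (-(x v * x v)) * hsq - x v * (∑ u ∈ G.neighborFinset v, x u) * hcancel

theorem dotV_normLap_mulVec_nonneg (G : SimpleGraph V) [DecidableRel G.Adj]
    (hd : ∀ v : V, 0 < G.degree v) (y : V → ℝ) : 0 ≤ dotV y ((normLap G).mulVec y) := by
  have hy : y = fun v => Real.sqrt (G.degree v) * (y v / Real.sqrt (G.degree v)) := by
    ext v
    have : Real.sqrt (G.degree v) ≠ 0 := (Real.sqrt_pos.2 (by exact_mod_cast hd v)).ne'
    field_simp
  rw [hy, dotV_normLap_mulVec G hd]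
  positivity

theorem cut_eq_sum (G : SimpleGraph V) [DecidableRel G.Adj] (S : Finset V) :
    (cut G S Sᶜ : ℝ) = ∑ u, ∑ v, if G.Adj u v ∧ u ∈ S ∧ v ∉ S then (1 : ℝ) else 0 := by
  simp only [cut, Nat.cast_sum, Finset.card_filter, Nat.cast_ite, Nat.cast_one, Nat.cast_zero]
  rw [← Finset.sum_filter_add_sum_filter_not Finset.univ (· ∈ S)]
  have hzero : ∑ u with u ∉ S, ∑ v, (if G.Adj u v ∧ u ∈ S ∧ v ∉ S then (1 : ℝ) else 0) = 0 :=
    Finset.sum_eq_zero fun u hu => Finset.sum_eq_zero fun v _ => by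
      simp_all
  rw [hzero, add_zero, Finset.filter_mem_eq_inter, Finset.univ_inter]
  refine Finset.sum_congr rfl fun u hu => ?_
  rw [← Finset.sum_filter_add_sum_filter_not Finset.univ (· ∈ Sᶜ)]
  have hzero' : ∑ v with v ∉ Sᶜ, (if G.Adj u v ∧ u ∈ S ∧ v ∉ S then (1 : ℝ) else 0) = 0 :=
    Finset.sum_eq_zero fun v hv => by simp_all
  rw [hzero', add_zero, Finset.filter_mem_eq_inter, Finset.univ_inter]
  refine Finset.sum_congr rfl fun v hv => ?_
  have hv' : v ∉ S := by simpa using hv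
  simp [hu, hv']

/-- The Rayleigh quotient of a normalized indicator vector is the conductance of the block. -/
theorem dotV_normLap_mulVec_gbar (G : SimpleGraph V) [DecidableRel G.Adj]
    (hd : ∀ v : V, 0 < G.degree v) {k : ℕ} (P : Fin k → Finset V) (i : Fin k) :
    dotV (gbar G P i) ((normLap G).mulVec (gbar G P i)) = conductance G (P i) := by
  have hg : gbar G P i = fun v => Real.sqrt (G.degree v) *
      ((if v ∈ P i then 1 else 0) / Real.sqrt (vol G (P i))) := by
    ext v
    simp only [gbar]
    split_ifs <;> simp [div_eq_mul_inv]
  have hsq : Real.sqrt (vol G (P i)) ^ 2 = vol G (P i) := Real.sq_sqrt (Nat.cast_nonneg _)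
  have hterm (u v : V) :
      (if G.Adj u v then ((if u ∈ P i then 1 else 0) / Real.sqrt (vol G (P i)) -
        (if v ∈ P i then 1 else 0) / Real.sqrt (vol G (P i))) ^ 2 else 0) =
      ((if G.Adj u v ∧ u ∈ P i ∧ v ∉ P i then (1 : ℝ) else 0) +
        (if G.Adj v u ∧ v ∈ P i ∧ u ∉ P i then (1 : ℝ) else 0)) / vol G (P i) := by
    rw [← sub_div, div_pow, hsq]
    simp only [G.adj_comm v u]
    by_cases h : G.Adj u v <;> by_cases hu : u ∈ P i <;> by_cases hv : v ∈ P i <;>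
      simp [h, hu, hv]
  rw [hg, dotV_normLap_mulVec G hd, conductance, cut_eq_sum]
  simp_rw [hterm, ← Finset.sum_div, Finset.sum_add_distrib]
  rw [Finset.sum_comm (f := fun u v => if G.Adj v u ∧ v ∈ P i ∧ u ∉ P i then (1 : ℝ) else 0)]
  ring

theorem dotV_gbar (G : SimpleGraph V) [DecidableRel G.Adj]
    (hd : ∀ v : V, 0 < G.degree v) {k : ℕ} {P : Fin k → Finset V} (hP : IsKWayPartition P)
    (i j : Fin k) : dotV (gbar G P i) (gbar G P j) = if i = j then 1 else 0 := by
  split_ifs with hij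
  · subst hij
    have hvol : (0 : ℝ) < vol G (P i) := by
      exact_mod_cast Finset.sum_pos (fun v _ => hd v) (hP.1 i)
    have hterm (v : V) : gbar G P i v * gbar G P i v =
        (if v ∈ P i then (G.degree v : ℝ) else 0) / vol G (P i) := by
      simp only [gbar]
      rw [div_mul_div_comm, Real.mul_self_sqrt hvol.le]
      split_ifs
      · rw [Real.mul_self_sqrt (Nat.cast_nonneg _)]
      · simp
    rw [dotV]
    simp_rw [hterm, ← Finset.sum_div]
    rw [Finset.sum_ite_mem, Finset.univ_inter, div_eq_one_iff_eq hvol.ne', vol, Nat.cast_sum]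
  · refine Finset.sum_eq_zero fun v _ => ?_
    by_cases hi : v ∈ P i
    · have hj : v ∉ P j := Finset.disjoint_left.1 (hP.2.1 i j hij) hi
      simp [gbar, hj]
    · simp [gbar, hi]

namespace EigenData

variable {G : SimpleGraph V} [DecidableRel G.Adj] {f : Fin (Fintype.card V) → V → ℝ}
  {lam : Fin (Fintype.card V) → ℝ}

theorem sum_mul_eq (hf : EigenData G f lam) (u v : V) :
    ∑ a, f a u * f a v = if u = v then 1 else 0 := by
  have h : Matrix.of f * (Matrix.of f)ᵀ = 1 := by
    ext a b
    simpa [Matrix.mul_apply, Matrix.one_apply, dotV] using hf.ortho a b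
  have h' := (Matrix.mul_eq_one_comm_of_equiv (Fintype.equivFin V).symm).1 h
  simpa [Matrix.mul_apply, Matrix.one_apply] using congrFun (congrFun h' u) v

/-- Expansion in the eigenbasis. -/
theorem eq_sum (hf : EigenData G f lam) (x : V → ℝ) (v : V) :
    x v = ∑ a, dotV x (f a) * f a v := by
  simp_rw [dotV, Finset.sum_mul, mul_assoc]
  rw [Finset.sum_comm]
  simp_rw [← Finset.mul_sum, hf.sum_mul_eq]
  simp

/-- Parseval's identity. -/
theorem sum_dotV_mul_dotV (hf : EigenData G f lam) (x y : V → ℝ) :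
    ∑ a, dotV x (f a) * dotV y (f a) = dotV x y := by
  have hx : dotV x y = ∑ v, (∑ a, dotV x (f a) * f a v) * y v :=
    Finset.sum_congr rfl fun v _ => by rw [← hf.eq_sum x v]
  rw [hx]
  simp_rw [Finset.sum_mul]
  rw [Finset.sum_comm]
  refine Finset.sum_congr rfl fun a _ => ?_
  rw [dotV, dotV, Finset.mul_sum]
  exact Finset.sum_congr rfl fun v _ => by ring

theorem dotV_mulVec (hf : EigenData G f lam) (x : V → ℝ) :
    dotV x ((normLap G).mulVec x) = ∑ a, lam a * dotV x (f a) ^ 2 := by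
  have hsymm : (normLap G)ᵀ = normLap G := by
    simp [normLap, Matrix.transpose_mul, Matrix.mul_assoc]
  rw [← hf.sum_dotV_mul_dotV]
  refine Finset.sum_congr rfl fun a _ => ?_
  have h : dotV ((normLap G).mulVec x) (f a) = lam a * dotV x (f a) := by
    change (normLap G).mulVec x ⬝ᵥ f a = lam a * (x ⬝ᵥ f a)
    rw [← smul_eq_mul, ← dotProduct_smul, ← hf.eig, Matrix.dotProduct_mulVec,
      ← Matrix.mulVec_transpose, hsymm]
  rw [h]
  ring

theorem lam_nonneg (hf : EigenData G f lam) (hd : ∀ v : V, 0 < G.degree v)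
    (a : Fin (Fintype.card V)) : 0 ≤ lam a := by
  have h := dotV_normLap_mulVec_nonneg G hd (f a)
  have h1 : dotV (f a) (lam a • f a) = lam a * dotV (f a) (f a) := dotProduct_smul _ _ _
  rwa [hf.eig, h1, hf.ortho, if_pos rfl, mul_one] at h

theorem lam_mul_sum_sq_le (hf : EigenData G f lam) (hd : ∀ v : V, 0 < G.degree v)
    (m : Fin (Fintype.card V)) (x : V → ℝ) :
    lam m * ∑ a with m ≤ a, dotV x (f a) ^ 2 ≤ dotV x ((normLap G).mulVec x) := by
  rw [hf.dotV_mulVec, Finset.mul_sum]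
  calc ∑ a with m ≤ a, lam m * dotV x (f a) ^ 2
      ≤ ∑ a with m ≤ a, lam a * dotV x (f a) ^ 2 :=
        Finset.sum_le_sum fun a ha => mul_le_mul_of_nonneg_right
          (hf.mono (Finset.mem_filter.1 ha).2) (sq_nonneg _)
    _ ≤ ∑ a, lam a * dotV x (f a) ^ 2 :=
        Finset.sum_le_sum_of_subset_of_nonneg (Finset.filter_subset _ _)
          fun a _ _ => mul_nonneg (hf.lam_nonneg hd a) (sq_nonneg _)

theorem dotV_fhat (hf : EigenData G f lam) {k : ℕ} (P : Fin k → Finset V) (j : Fin k)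
    (b : Fin (Fintype.card V)) :
    dotV (fhat G P f j) (f b) = if (b : ℕ) < k then alpha G P f j b else 0 := by
  have h : dotV (fhat G P f j) (f b) =
      ∑ a : Fin (Fintype.card V), (if (a : ℕ) < k then alpha G P f j a else 0) * dotV (f a) (f b) := by
    simp_rw [dotV, fhat, Finset.sum_mul, Finset.mul_sum]
    rw [Finset.sum_comm]
    refine Finset.sum_congr rfl fun a _ => Finset.sum_congr rfl fun v _ => ?_
    split_ifs <;> ring
  simp [h, hf.ortho]

end EigenData

theorem sum_castLE {k n : ℕ} (h : k ≤ n) (g : Fin n → ℝ) :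
    ∑ a : Fin k, g (Fin.castLE h a) = ∑ a : Fin n with a.val < k, g a := by
  obtain ⟨l, rfl⟩ := Nat.exists_eq_add_of_le h
  rw [Finset.sum_filter, Fin.sum_univ_add]
  simp [Fin.castAdd]

/-- A solution of `M = 1 + M * E` with `E` entrywise small has small off-diagonal entries. -/
theorem abs_apply_le_of_eq_one_add_mul {k : ℕ} {M E : Matrix (Fin k) (Fin k) ℝ} {s t : ℝ}
    (hM : M = 1 + M * E) (hE : ∀ i j, |E i j| ≤ t) (hts : k * t ≤ s) (hs : s ≤ 1 / 2)
    {i j : Fin k} (hij : i ≠ j) : |M i j| ≤ 2 * s := by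
  obtain ⟨⟨p, q⟩, -, hmax⟩ := Finset.exists_max_image (Finset.univ : Finset (Fin k × Fin k))
    (fun x => |M x.1 x.2|) ⟨(i, j), Finset.mem_univ _⟩
  have hbound (a b : Fin k) : |(M * E) a b| ≤ |M p q| * s :=
    calc |(M * E) a b| ≤ ∑ l, |M a l * E l b| := by
          rw [Matrix.mul_apply]
          exact Finset.abs_sum_le_sum_abs _ _
      _ ≤ ∑ _l : Fin k, |M p q| * t := Finset.sum_le_sum fun l _ => by
          rw [abs_mul]
          exact mul_le_mul (hmax (a, l) (Finset.mem_univ _)) (hE l b) (abs_nonneg _)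
            (abs_nonneg _)
      _ = |M p q| * (k * t) := by simp; ring
      _ ≤ |M p q| * s := mul_le_mul_of_nonneg_left hts (abs_nonneg _)
  have hs0 : 0 ≤ s :=
    le_trans (mul_nonneg (Nat.cast_nonneg _) ((abs_nonneg _).trans (hE i j))) hts
  have hpq : |M p q| ≤ 2 := by
    have h1 : |M p q| ≤ |(1 : Matrix (Fin k) (Fin k) ℝ) p q| + |(M * E) p q| := by
      conv_lhs => rw [hM]
      exact abs_add_le _ _
    have h2 : |(1 : Matrix (Fin k) (Fin k) ℝ) p q| ≤ 1 := by
      rw [Matrix.one_apply]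
      split_ifs <;> simp
    nlinarith [hbound p q, abs_nonneg (M p q)]
  have hoff : M i j = (M * E) i j := by
    conv_lhs => rw [hM]
    simp [Matrix.one_apply_ne hij]
  rw [hoff]
  exact (hbound i j).trans (mul_le_mul_of_nonneg_right hpq hs0)

theorem rows_of_B_almost_orthogonal
    {V : Type} [Fintype V] [DecidableEq V] (G : SimpleGraph V) [DecidableRel G.Adj]
    (hd : ∀ v : V, 0 < G.degree v)
    {k : ℕ} (hkn : k < Fintype.card V)
    (f : Fin (Fintype.card V) → V → ℝ) (lam : Fin (Fintype.card V) → ℝ)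
    (hf : EigenData G f lam)
    (P : Fin k → Finset V) (hP : AchievesRhoAvr G P)
    (beta : Fin k → Fin k → ℝ)
    (hbeta : ∀ i : Fin k,
      f (Fin.castLE hkn.le i) = fun v => ∑ j : Fin k, beta i j * fhat G P f j v)
    (ε : ℝ) (hε0 : 0 < ε) (hε1 : ε < 1)
    (hPsi : Psi G lam P hkn ≥ (10 : ℝ) ^ 4 * (k : ℝ) ^ 3 / ε ^ 2) :
    ∀ i j : Fin k, i ≠ j → |∑ l : Fin k, beta l i * beta l j| ≤ Real.sqrt ε := by
  intro i j hij
  have hk : 0 < k := i.pos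
  have hkR : (1 : ℝ) ≤ k := by exact_mod_cast hk
  set m : Fin (Fintype.card V) := ⟨k, hkn⟩
  set A : Matrix (Fin k) (Fin k) ℝ :=
    Matrix.of fun i a => alpha G P f i (Fin.castLE hkn.le a)
  set B : Matrix (Fin k) (Fin k) ℝ := Matrix.of beta
  set E : Matrix (Fin k) (Fin k) ℝ :=
    Matrix.of fun i j => ∑ a with m ≤ a, alpha G P f i a * alpha G P f j a
  have hBA : B * A = 1 := by
    ext i b
    have h := hf.ortho (Fin.castLE hkn.le i) (Fin.castLE hkn.le b)
    have h' : dotV (fun v => ∑ j, beta i j * fhat G P f j v) (f (Fin.castLE hkn.le b)) =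
        ∑ j, beta i j * dotV (fhat G P f j) (f (Fin.castLE hkn.le b)) := by
      simp_rw [dotV, Finset.sum_mul, Finset.mul_sum]
      rw [Finset.sum_comm]
      simp_rw [mul_assoc]
    rw [hbeta i, h'] at h
    simpa [hf.dotV_fhat, Matrix.mul_apply, Matrix.one_apply, A, B] using h
  have hAB : A * B = 1 := mul_eq_one_comm.1 hBA
  have hAA : A * Aᵀ = 1 - E := by
    ext p q
    have h := hf.sum_dotV_mul_dotV (gbar G P p) (gbar G P q)
    rw [dotV_gbar G hd hP.1, ← Finset.sum_filter_add_sum_filter_not _ (m ≤ ·)] at h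
    simp only [Matrix.mul_apply, Matrix.transpose_apply, Matrix.sub_apply, Matrix.one_apply,
      Matrix.of_apply, A, E]
    rw [sum_castLE hkn.le fun a => alpha G P f p a * alpha G P f q a, eq_sub_iff_add_eq', ← h]
    simp only [alpha, m, Fin.le_def, not_le]
  have hM : Bᵀ * B = 1 + Bᵀ * B * E := by
    have h : Bᵀ * B * (1 - E) = 1 := by
      rw [← hAA, ← Matrix.mul_assoc, Matrix.mul_assoc Bᵀ, hBA, Matrix.mul_one,
        ← Matrix.transpose_mul, hAB, Matrix.transpose_one]
    rw [Matrix.mul_sub, Matrix.mul_one, sub_eq_iff_eq_add] at h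
    exact h
  have hE (p q : Fin k) : |E p q| ≤ ε ^ 2 / (10 ^ 4 * k ^ 2) := by
    have hcond (p : Fin k) : 0 ≤ conductance G (P p) := by unfold conductance; positivity
    have hsum : 0 ≤ ∑ p, conductance G (P p) := Finset.sum_nonneg fun p _ => hcond p
    have hPsi_pos : 0 < Psi G lam P hkn := lt_of_lt_of_le (by positivity) hPsi
    have havg : 0 < avgCond G P := by
      refine lt_of_le_of_ne (div_nonneg hsum (Nat.cast_nonneg _)) fun h => ?_
      rw [Psi, ← h, div_zero] at hPsi_pos
      exact lt_irrefl _ hPsi_pos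
    have hlam : 10 ^ 4 * (k : ℝ) ^ 3 / ε ^ 2 * avgCond G P ≤ lam m :=
      (le_div_iff₀ havg).1 hPsi
    have hlam_pos : 0 < lam m := lt_of_lt_of_le (by positivity) hlam
    have hdiag (p : Fin k) :
        ∑ a with m ≤ a, alpha G P f p a ^ 2 ≤ ε ^ 2 / (10 ^ 4 * k ^ 2) := by
      have h1 := hf.lam_mul_sum_sq_le hd m (gbar G P p)
      rw [dotV_normLap_mulVec_gbar G hd] at h1
      have h2 : conductance G (P p) ≤ k * avgCond G P := by
        rw [avgCond, mul_div_cancel₀ _ (by positivity)]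
        exact Finset.single_le_sum (fun p _ => hcond p) (Finset.mem_univ p)
      have h3 : k * avgCond G P ≤ lam m * (ε ^ 2 / (10 ^ 4 * k ^ 2)) := by
        calc k * avgCond G P
            = 10 ^ 4 * (k : ℝ) ^ 3 / ε ^ 2 * avgCond G P * (ε ^ 2 / (10 ^ 4 * k ^ 2)) := by
              field_simp
          _ ≤ _ := mul_le_mul_of_nonneg_right hlam (by positivity)
      exact le_of_mul_le_mul_left (h1.trans (h2.trans h3)) hlam_pos
    refine abs_le_of_sq_le_sq ?_ (by positivity)
    calc E p q ^ 2
        ≤ (∑ a with m ≤ a, alpha G P f p a ^ 2) * ∑ a with m ≤ a, alpha G P f q a ^ 2 :=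
          Finset.sum_mul_sq_le_sq_mul_sq (Finset.univ.filter (m ≤ ·)) (alpha G P f p) (alpha G P f q)
      _ ≤ ε ^ 2 / (10 ^ 4 * k ^ 2) * (ε ^ 2 / (10 ^ 4 * k ^ 2)) :=
          mul_le_mul (hdiag p) (hdiag q) (Finset.sum_nonneg fun _ _ => sq_nonneg _)
            (by positivity)
      _ = _ := (sq _).symm
  have hsmall : k * (ε ^ 2 / (10 ^ 4 * k ^ 2)) ≤ ε / 2 := by
    rw [show k * (ε ^ 2 / (10 ^ 4 * (k : ℝ) ^ 2)) = ε ^ 2 / (10 ^ 4 * k) by field_simp,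
      div_le_iff₀ (by positivity)]
    nlinarith
  have hentry := abs_apply_le_of_eq_one_add_mul hM hE hsmall (by linarith) hij
  have hBB : (Bᵀ * B) i j = ∑ l, beta l i * beta l j := by
    simp [Matrix.mul_apply, B]
  rw [← hBB]
  refine hentry.trans ?_
  rw [mul_div_cancel₀ _ two_ne_zero]
  exact Real.le_sqrt_of_sq_le (by nlinarith)

end SpectralClustering
end

section
/- Let (A_1,…,A_k) be a k-way partition of V with centers c_1,…,c_k and suppose that for every permutation π of {1,…,k} there exists an index i ∈ {1,…,k} with μ(A_i △ P_{π(i)}) ≥ 2ε·μ(P_{π(i)}), where ε ∈ (0,1/2). If Ψ = 20^4·k^3/δ for some δ ∈ (0,1/2], then Cost({A_i,c_i}_{i=1}^k) ≥ ε/16 − 2k²/Ψ. -/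
open Finset BigOperators Matrix

namespace SpectralClustering

variable {V : Type} [Fintype V] [DecidableEq V]

/-- A disjoint cover indexed by `ι` is the family of fibres of a map to `ι`. -/
lemma exists_label {V ι : Type*} [Fintype V] [DecidableEq ι] (A : ι → Finset V)
    (hdisj : ∀ i j, i ≠ j → Disjoint (A i) (A j)) (hcover : ∀ v : V, ∃ i, v ∈ A i) :
    ∃ θ : V → ι, A = fun i => univ.filter fun u => θ u = i := by
  choose θ hθ using hcover
  refine ⟨θ, ?_⟩
  ext i u
  simp only [mem_filter, mem_univ, true_and]
  refine ⟨fun h => ?_, fun h => h ▸ hθ u⟩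
  by_contra hne
  exact Finset.disjoint_left.mp (hdisj _ _ hne) (hθ u) h

/-- Clustering well-separated centers `p` with labels far from `τ` is expensive. -/
lemma cost_ge_of_separated {V ι κ : Type*} [Fintype V] [DecidableEq V] [Fintype ι]
    [DecidableEq ι] [Fintype κ]
    (d : V → ℝ) (hd : ∀ u, 0 ≤ d u) (τ θ : V → ι) (m : ι → ℝ) (hm : ∀ i, 0 < m i)
    (hmτ : ∀ i, ∑ u with τ u = i, d u = m i) (p c : ι → κ → ℝ)
    (hsep : ∀ a b, a ≠ b → 1 / 4 * (1 / m a + 1 / m b) ≤ ∑ j, (p a j - p b j) ^ 2)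
    {ε : ℝ} (hε : ε < 1 / 2)
    (hfar : ∀ π : Equiv.Perm ι, ∃ i, 2 * ε * m (π i) ≤
      ∑ u ∈ symmDiff (univ.filter fun u => θ u = i) (univ.filter fun u => τ u = π i), d u) :
    ε / 8 ≤ ∑ u, d u * ∑ j, (p (τ u) j - c (θ u) j) ^ 2 := by
  have hne : Nonempty ι := ⟨(hfar 1).choose⟩
  choose σ hσ using fun i => Finite.exists_min fun a => ∑ j, (p a j - c i j) ^ 2
  have hmis : ∀ u, τ u ≠ σ (θ u) →
      1 / 16 * (1 / m (τ u) + 1 / m (σ (θ u))) ≤ ∑ j, (p (τ u) j - c (θ u) j) ^ 2 := by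
    intro u hu
    have htri : ∑ j, (p (τ u) j - p (σ (θ u)) j) ^ 2 ≤
        2 * ∑ j, (p (τ u) j - c (θ u) j) ^ 2 + 2 * ∑ j, (p (σ (θ u)) j - c (θ u) j) ^ 2 := by
      rw [mul_sum, mul_sum, ← sum_add_distrib]
      refine sum_le_sum fun j _ => ?_
      nlinarith [sq_nonneg ((p (τ u) j - c (θ u) j) + (p (σ (θ u)) j - c (θ u) j))]
    have := hσ (θ u) (τ u)
    have := hsep _ _ hu
    linarith
  have hrestrict : ∀ (S : Finset V) (r : ℝ), (∀ u ∈ S, r ≤ ∑ j, (p (τ u) j - c (θ u) j) ^ 2) →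
      (∑ u ∈ S, d u) * r ≤ ∑ u, d u * ∑ j, (p (τ u) j - c (θ u) j) ^ 2 := by
    intro S r h
    rw [sum_mul]
    refine (sum_le_sum fun u hu => mul_le_mul_of_nonneg_left (h u hu) (hd u)).trans ?_
    exact sum_le_sum_of_subset_of_nonneg (subset_univ S) fun u _ _ =>
      mul_nonneg (hd u) (sum_nonneg fun j _ => sq_nonneg _)
  have hinv : ∀ i, 0 < 1 / m i := fun i => one_div_pos.mpr (hm i)
  by_cases hsurj : Function.Surjective σ
  · obtain ⟨i, hi⟩ := hfar (Equiv.ofBijective σ (Finite.surjective_iff_bijective.mp hsurj))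
    simp only [Equiv.ofBijective_apply] at hi
    refine le_trans ?_ (hrestrict
      (symmDiff (univ.filter fun u => θ u = i) (univ.filter fun u => τ u = σ i))
      (1 / 16 * (1 / m (σ i))) ?_)
    · calc ε / 8 = 2 * ε * m (σ i) * (1 / 16 * (1 / m (σ i))) := by
            have := (hm (σ i)).ne'
            field_simp
            ring
        _ ≤ _ := mul_le_mul_of_nonneg_right hi (by have := hinv (σ i); positivity)
    · intro u hu
      simp only [mem_symmDiff, mem_filter, mem_univ, true_and] at hu
      have h1 := hinv (τ u)
      have h2 := hinv (σ (θ u))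
      rcases hu with ⟨h, h'⟩ | ⟨h, h'⟩
      · have := hmis u (by rwa [h])
        rw [← h]
        linarith
      · have := hmis u fun hc =>
          h' ((Finite.injective_iff_surjective.mpr hsurj) (hc.symm.trans h))
        rw [← h]
        linarith
  · obtain ⟨b, hb⟩ := not_forall.mp hsurj
    have := hrestrict (univ.filter fun u => τ u = b) (1 / 16 * (1 / m b)) ?_
    · rw [hmτ] at this
      have h : m b * (1 / 16 * (1 / m b)) = 1 / 16 := by
        have := (hm b).ne'
        field_simp
      linarith
    · intro u hu
      simp only [mem_filter, mem_univ, true_and] at hu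
      have := hmis u fun hc => hb ⟨θ u, hc ▸ hu⟩
      have := hinv (σ (θ u))
      rw [← hu]
      linarith

lemma sum_adj_left {V : Type*} [Fintype V] (G : SimpleGraph V) [DecidableRel G.Adj]
    (y : V → ℝ) :
    ∑ u, ∑ v, (if G.Adj u v then y u else 0) = ∑ u, G.degree u * y u := by
  refine sum_congr rfl fun u _ => ?_
  rw [← sum_filter, sum_const, nsmul_eq_mul, ← G.card_neighborFinset_eq_degree,
    G.neighborFinset_eq_filter]

section Spectral

variable {G : SimpleGraph V} [DecidableRel G.Adj]

lemma normLap_apply (u v : V) : normLap G u v = (if u = v then 1 else 0) -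
    (Real.sqrt (G.degree u))⁻¹ * (if G.Adj u v then 1 else 0) * (Real.sqrt (G.degree v))⁻¹ := by
  rw [normLap, Matrix.sub_apply, Matrix.one_apply, Matrix.mul_diagonal, Matrix.diagonal_mul,
    SimpleGraph.adjMatrix_apply]

lemma dotV_normLap_comm (x y : V → ℝ) :
    dotV (normLap G *ᵥ x) y = dotV x (normLap G *ᵥ y) := by
  simp only [dotV, Matrix.mulVec, dotProduct, sum_mul, mul_sum]
  rw [sum_comm]
  refine sum_congr rfl fun u _ => sum_congr rfl fun v _ => ?_
  rw [normLap_apply, normLap_apply]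
  simp only [G.adj_comm u v, eq_comm (a := u) (b := v)]
  ring

lemma dotV_normLap (x : V → ℝ) : dotV x (normLap G *ᵥ x) = dotV x x -
    ∑ u, ∑ v, if G.Adj u v then
      x u / Real.sqrt (G.degree u) * (x v / Real.sqrt (G.degree v)) else 0 := by
  simp only [dotV, Matrix.mulVec, dotProduct, mul_sum]
  rw [← sum_sub_distrib]
  refine sum_congr rfl fun u _ => ?_
  have h : x u * x u = ∑ v, if u = v then x u * x v else 0 := by simp
  rw [h, ← sum_sub_distrib]
  refine sum_congr rfl fun v _ => ?_
  rw [normLap_apply]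
  split_ifs <;> simp [div_eq_mul_inv] <;> ring

lemma normLap_nonneg (hd : ∀ v : V, 0 < G.degree v) (x : V → ℝ) :
    0 ≤ dotV x (normLap G *ᵥ x) := by
  rw [dotV_normLap, sub_nonneg]
  set y : V → ℝ := fun u => x u / Real.sqrt (G.degree u)
  have hx : dotV x x = ∑ u, G.degree u * (y u) ^ 2 := by
    refine sum_congr rfl fun u _ => ?_
    have : (0 : ℝ) < G.degree u := by exact_mod_cast hd u
    simp only [y, div_pow, Real.sq_sqrt this.le]
    field_simp
  have h1 := sum_adj_left G fun u => y u ^ 2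
  have h2 : ∑ u, ∑ v, (if G.Adj u v then y v ^ 2 else 0) = ∑ u, G.degree u * (y u) ^ 2 := by
    rw [sum_comm, ← h1]
    exact sum_congr rfl fun u _ => sum_congr rfl fun v _ => by simp only [G.adj_comm]
  have h3 : ∑ u, ∑ v, (if G.Adj u v then y u * y v else 0) ≤
      ∑ u, ∑ v, ((if G.Adj u v then y u ^ 2 else 0) / 2
        + (if G.Adj u v then y v ^ 2 else 0) / 2) := by
    refine sum_le_sum fun u _ => sum_le_sum fun v _ => ?_
    split_ifs
    · nlinarith [sq_nonneg (y u - y v)]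
    · simp
  simp only [sum_add_distrib, ← sum_div, h1, h2] at h3
  rw [hx]
  linarith

lemma EigenData.sum_coeff_mul {f : Fin (Fintype.card V) → V → ℝ}
    {lam : Fin (Fintype.card V) → ℝ} (hf : EigenData G f lam) (x y : V → ℝ) :
    ∑ j, dotV x (f j) * dotV y (f j) = dotV x y := by
  have hQ : Matrix.of f * (Matrix.of f)ᵀ = 1 := by
    ext i j
    have := hf.ortho i j
    simpa [Matrix.mul_apply, Matrix.one_apply, dotV] using this
  have hQ' : (Matrix.of f)ᵀ * Matrix.of f = 1 :=
    (Matrix.mul_eq_one_comm_of_card_eq _ _ _ (by simp)).mp hQ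
  have h := congrArg (fun M => x ⬝ᵥ (M *ᵥ y)) hQ'
  simp only [Matrix.one_mulVec, ← Matrix.mulVec_mulVec, Matrix.dotProduct_mulVec,
    Matrix.vecMul_transpose] at h
  rw [← Matrix.dotProduct_mulVec] at h
  rw [show dotV x y = x ⬝ᵥ y from rfl, ← h]
  simp [dotV, dotProduct, Matrix.mulVec, mul_comm]

lemma EigenData.lam_nonneg_s17 (hd : ∀ v : V, 0 < G.degree v) {f : Fin (Fintype.card V) → V → ℝ}
    {lam : Fin (Fintype.card V) → ℝ} (hf : EigenData G f lam) (j : Fin (Fintype.card V)) :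
    0 ≤ lam j := by
  have h := normLap_nonneg hd (f j)
  have h1 := hf.ortho j j
  rw [hf.eig j] at h
  simp only [dotV, Pi.smul_apply, smul_eq_mul, if_true] at h h1
  simp only [mul_left_comm _ (lam j)] at h
  rwa [← mul_sum, h1, mul_one] at h

lemma EigenData.sum_lam_coeff_sq {f : Fin (Fintype.card V) → V → ℝ}
    {lam : Fin (Fintype.card V) → ℝ} (hf : EigenData G f lam) (x : V → ℝ) :
    ∑ j, lam j * dotV x (f j) ^ 2 = dotV x (normLap G *ᵥ x) := by
  rw [← hf.sum_coeff_mul]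
  refine sum_congr rfl fun j _ => ?_
  rw [dotV_normLap_comm, hf.eig j]
  have : dotV x (lam j • f j) = lam j * dotV x (f j) := by
    simp only [dotV, Pi.smul_apply, smul_eq_mul, mul_left_comm, ← mul_sum]
  rw [this]
  ring

/-- The part of `x` outside the first `k` eigenvectors is controlled by its Rayleigh quotient. -/
lemma EigenData.lam_mul_tail_le (hd : ∀ v : V, 0 < G.degree v)
    {f : Fin (Fintype.card V) → V → ℝ}
    {lam : Fin (Fintype.card V) → ℝ} (hf : EigenData G f lam) {k : ℕ}
    (hkn : k < Fintype.card V) (x : V → ℝ) :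
    lam ⟨k, hkn⟩ * ∑ j with ¬ j.val < k, dotV x (f j) ^ 2 ≤ dotV x (normLap G *ᵥ x) := by
  rw [← hf.sum_lam_coeff_sq, mul_sum]
  refine (sum_le_sum fun j hj => ?_).trans (sum_le_sum_of_subset_of_nonneg (subset_univ _)
    fun j _ _ => mul_nonneg (hf.lam_nonneg_s17 hd j) (sq_nonneg _))
  refine mul_le_mul_of_nonneg_right (hf.mono ?_) (sq_nonneg _)
  exact Fin.mk_le_of_le_val (not_lt.mp (mem_filter.mp hj).2)

lemma sum_head_add_tail {n k : ℕ} (hk : k ≤ n) (a : Fin n → ℝ) :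
    ∑ j : Fin k, a (Fin.castLE hk j) + ∑ j with ¬ j.val < k, a j = ∑ j, a j := by
  rw [← sum_filter_add_sum_filter_not univ fun j : Fin n => j.val < k]
  congr 1
  refine sum_bij (fun j _ => Fin.castLE hk j) (by simp) (by simp) ?_ (by simp)
  intro b hb
  exact ⟨⟨b, (mem_filter.mp hb).2⟩, mem_univ _, rfl⟩

lemma dotV_gbar_s17 {k : ℕ} (P : Fin k → Finset V) (i : Fin k) (x : V → ℝ) :
    dotV (gbar G P i) x =
      (∑ u ∈ P i, Real.sqrt (G.degree u) * x u) / Real.sqrt (vol G (P i)) := by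
  simp only [dotV, gbar, sum_div, ite_div, ite_mul, zero_div, zero_mul]
  rw [← sum_filter, filter_mem_eq_inter, univ_inter]
  exact sum_congr rfl fun u _ => by ring

lemma dotV_gbar_self {k : ℕ} (P : Fin k → Finset V) (i : Fin k) (h : 0 < vol G (P i)) :
    dotV (gbar G P i) (gbar G P i) = 1 := by
  have h' : (0 : ℝ) < vol G (P i) := by exact_mod_cast h
  rw [dotV_gbar_s17, div_eq_one_iff_eq (Real.sqrt_pos.mpr h').ne']
  have : ∀ u ∈ P i, Real.sqrt (G.degree u) * gbar G P i u =
      G.degree u / Real.sqrt (vol G (P i)) := by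
    intro u hu
    rw [gbar, if_pos hu, ← mul_div_assoc, Real.mul_self_sqrt (Nat.cast_nonneg _)]
  rw [sum_congr rfl this, ← sum_div, ← Nat.cast_sum]
  exact Real.div_sqrt

lemma dotV_gbar_of_disjoint {k : ℕ} (P : Fin k → Finset V) {a b : Fin k}
    (h : Disjoint (P a) (P b)) : dotV (gbar G P a) (gbar G P b) = 0 := by
  rw [dotV_gbar_s17, sum_eq_zero, zero_div]
  intro u hu
  rw [gbar, if_neg (disjoint_left.mp h hu)]
  simp

lemma dotV_gbar_normLap (hd : ∀ v : V, 0 < G.degree v) {k : ℕ} (P : Fin k → Finset V)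
    (i : Fin k) (h : 0 < vol G (P i)) :
    dotV (gbar G P i) (normLap G *ᵥ gbar G P i) = conductance G (P i) := by
  have h' : (0 : ℝ) < vol G (P i) := by exact_mod_cast h
  have hy : ∀ u, gbar G P i u / Real.sqrt (G.degree u) =
      if u ∈ P i then (Real.sqrt (vol G (P i)))⁻¹ else 0 := by
    intro u
    have : Real.sqrt (G.degree u) ≠ 0 := (Real.sqrt_pos.mpr (by exact_mod_cast hd u)).ne'
    rw [gbar]
    split_ifs
    · field_simp
    · simp
  have hin : ∑ u, ∑ v, (if G.Adj u v then gbar G P i u / Real.sqrt (G.degree u) *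
      (gbar G P i v / Real.sqrt (G.degree v)) else 0) = cut G (P i) (P i) / vol G (P i) := by
    have hv : ∀ u v, (if G.Adj u v then gbar G P i u / Real.sqrt (G.degree u) *
        (gbar G P i v / Real.sqrt (G.degree v)) else 0) =
        if u ∈ P i then (if v ∈ P i then (if G.Adj u v then 1 / (vol G (P i) : ℝ) else 0) else 0)
        else 0 := by
      intro u v
      rw [hy, hy]
      split_ifs <;> simp [← mul_inv, Real.mul_self_sqrt h'.le]
    simp only [hv, cut, sum_ite_irrel, sum_const_zero, sum_ite_mem, univ_inter]
    simp [← sum_filter, ← sum_mul, div_eq_mul_inv]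
  have hsplit : cut G (P i) (P i) + cut G (P i) (P i)ᶜ = vol G (P i) := by
    rw [cut, cut, vol, ← sum_add_distrib]
    refine sum_congr rfl fun u _ => ?_
    rw [← card_union_of_disjoint (disjoint_filter_filter disjoint_compl_right), ← filter_union,
      union_compl, ← G.card_neighborFinset_eq_degree, G.neighborFinset_eq_filter]
  rw [dotV_normLap, dotV_gbar_self P i h, hin, conductance, eq_div_iff h'.ne', sub_mul,
    div_mul_cancel₀ _ h'.ne', ← hsplit]
  push_cast
  ring

/-- The embedding restricted to the first `k` eigenvectors is close to the block-constant
embedding given by the coefficients `alpha`. -/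
lemma sum_embedding_sub_center_sq (hd : ∀ v : V, 0 < G.degree v)
    {f : Fin (Fintype.card V) → V → ℝ} {lam : Fin (Fintype.card V) → ℝ} (hf : EigenData G f lam)
    {k : ℕ} (hk : k ≤ Fintype.card V) (P : Fin k → Finset V)
    (hvol : ∀ i, 0 < vol G (P i)) {τ : V → Fin k}
    (hτ : P = fun i => univ.filter fun u => τ u = i) :
    ∑ u, (G.degree u : ℝ) * ∑ j, (Femb G f hk u j -
      alpha G P f (τ u) (Fin.castLE hk j) / Real.sqrt (vol G (P (τ u)))) ^ 2 =
    ∑ i, ∑ j with ¬ j.val < k, alpha G P f i j ^ 2 := by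
  have hP : ∀ u i, u ∈ P i ↔ τ u = i := fun u i => by simp [hτ]
  have hfib : ∀ g : V → Fin k → ℝ, ∑ u, g u (τ u) = ∑ i, ∑ u ∈ P i, g u i := by
    intro g
    rw [← sum_fiberwise univ τ]
    refine sum_congr rfl fun i _ => ?_
    rw [hτ]
    exact sum_congr rfl fun u hu => by rw [(mem_filter.mp hu).2]
  have hcol : ∀ j : Fin (Fintype.card V), ∑ u, (G.degree u : ℝ) *
      (f j u / Real.sqrt (G.degree u) - alpha G P f (τ u) j / Real.sqrt (vol G (P (τ u)))) ^ 2 =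
      1 - ∑ i, alpha G P f i j ^ 2 := by
    intro j
    have hexp : ∀ u, (G.degree u : ℝ) * (f j u / Real.sqrt (G.degree u) -
        alpha G P f (τ u) j / Real.sqrt (vol G (P (τ u)))) ^ 2 = f j u * f j u -
        (2 * (alpha G P f (τ u) j * (Real.sqrt (G.degree u) * f j u
          / Real.sqrt (vol G (P (τ u))))) -
        alpha G P f (τ u) j ^ 2 * (G.degree u / vol G (P (τ u)))) := by
      intro u
      have h1 : (0 : ℝ) < G.degree u := by exact_mod_cast hd u
      have h2 : (0 : ℝ) < vol G (P (τ u)) := by exact_mod_cast hvol _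
      have h3 := Real.sq_sqrt h1.le
      have h4 := Real.sq_sqrt h2.le
      have h5 := (Real.sqrt_pos.mpr h1).ne'
      have h6 := (Real.sqrt_pos.mpr h2).ne'
      generalize Real.sqrt (G.degree u) = s at *
      generalize Real.sqrt (vol G (P (τ u))) = t at *
      rw [← h3, ← h4]
      field_simp
      ring
    simp only [hexp]
    rw [sum_sub_distrib]
    have hone : ∑ u, f j u * f j u = 1 := by simpa [dotV] using hf.ortho j j
    rw [hone, hfib fun u i => 2 * (alpha G P f i j * (Real.sqrt (G.degree u) * f j u
          / Real.sqrt (vol G (P i)))) - alpha G P f i j ^ 2 * (G.degree u / vol G (P i))]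
    congr 1
    refine sum_congr rfl fun i _ => ?_
    have h2 : (vol G (P i) : ℝ) ≠ 0 := by exact_mod_cast (hvol i).ne'
    have hv : ∑ u ∈ P i, (G.degree u : ℝ) = vol G (P i) := by rw [vol, Nat.cast_sum]
    rw [sum_sub_distrib, ← mul_sum, ← mul_sum, ← mul_sum, ← sum_div, ← sum_div, ← dotV_gbar_s17, hv,
      div_self h2]
    change 2 * (alpha G P f i j * alpha G P f i j) - _ = _
    ring
  have hrow : ∀ i, ∑ j, alpha G P f i j ^ 2 = 1 := by
    intro i
    rw [← dotV_gbar_self P i (hvol i), ← hf.sum_coeff_mul]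
    exact sum_congr rfl fun j _ => sq _
  simp only [mul_sum]
  rw [sum_comm]
  simp only [Femb, hcol]
  have htail : ∀ i, ∑ j with ¬ j.val < k, alpha G P f i j ^ 2 =
      1 - ∑ j : Fin k, alpha G P f i (Fin.castLE hk j) ^ 2 := by
    intro i
    rw [← hrow i, ← sum_head_add_tail hk]
    ring
  simp only [htail, sum_sub_distrib]
  rw [sum_comm]

/-- The centers built from `alpha` are pairwise separated. -/
lemma center_separation {f : Fin (Fintype.card V) → V → ℝ} {lam : Fin (Fintype.card V) → ℝ}
    (hf : EigenData G f lam) {k : ℕ} (hk : k ≤ Fintype.card V) (P : Fin k → Finset V)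
    (hvol : ∀ i, 0 < vol G (P i)) {a b : Fin k} (hab : a ≠ b) (hdisj : Disjoint (P a) (P b)) :
    (1 - ∑ i, ∑ j with ¬ j.val < k, alpha G P f i j ^ 2) *
      (1 / (vol G (P a) : ℝ) + 1 / (vol G (P b) : ℝ)) ≤
    ∑ j : Fin k, (alpha G P f a (Fin.castLE hk j) / Real.sqrt (vol G (P a)) -
      alpha G P f b (Fin.castLE hk j) / Real.sqrt (vol G (P b))) ^ 2 := by
  have ha : (0 : ℝ) < vol G (P a) := by exact_mod_cast hvol a
  have hb : (0 : ℝ) < vol G (P b) := by exact_mod_cast hvol b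
  have hmix : ∀ x y : Fin k, ∑ j, alpha G P f x j * alpha G P f y j =
      dotV (gbar G P x) (gbar G P y) := fun x y => hf.sum_coeff_mul _ _
  have hexp : ∀ x y s t : ℝ, (x / s - y / t) ^ 2 =
      x * x * (1 / s ^ 2) + y * y * (1 / t ^ 2) - x * y * (2 * (1 / s) * (1 / t)) := by
    intro x y s t
    ring
  have hall : ∑ j, (alpha G P f a j / Real.sqrt (vol G (P a)) -
      alpha G P f b j / Real.sqrt (vol G (P b))) ^ 2 =
      1 / (vol G (P a) : ℝ) + 1 / (vol G (P b) : ℝ) := by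
    simp only [hexp, sum_sub_distrib, sum_add_distrib, ← sum_mul, hmix]
    rw [dotV_gbar_self P a (hvol a), dotV_gbar_self P b (hvol b), dotV_gbar_of_disjoint P hdisj,
      Real.sq_sqrt ha.le, Real.sq_sqrt hb.le]
    ring
  have hinv : 0 ≤ 1 / (vol G (P a) : ℝ) + 1 / (vol G (P b) : ℝ) := by positivity
  have htail : ∑ j with ¬ j.val < k, (alpha G P f a j / Real.sqrt (vol G (P a)) -
      alpha G P f b j / Real.sqrt (vol G (P b))) ^ 2 ≤
      (∑ i, ∑ j with ¬ j.val < k, alpha G P f i j ^ 2) *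
        (1 / (vol G (P a) : ℝ) + 1 / (vol G (P b) : ℝ)) := by
    refine le_trans ?_ (mul_le_mul_of_nonneg_right
      (sum_le_sum_of_subset_of_nonneg (subset_univ {a, b}) fun i _ _ =>
        sum_nonneg fun j _ => sq_nonneg _) hinv)
    rw [sum_pair hab, ← sum_add_distrib, sum_mul]
    refine sum_le_sum fun j _ => ?_
    rw [← Real.sq_sqrt ha.le, ← Real.sq_sqrt hb.le, Real.sqrt_sq (Real.sqrt_nonneg _),
      Real.sqrt_sq (Real.sqrt_nonneg _)]
    simp only [div_eq_mul_inv, one_mul, ← inv_pow]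
    nlinarith [sq_nonneg (alpha G P f a j * (Real.sqrt (vol G (P b)))⁻¹ +
      alpha G P f b j * (Real.sqrt (vol G (P a)))⁻¹)]
  rw [← sum_head_add_tail hk] at hall
  linarith

end Spectral

theorem cost_lower_bound_eps_far_partitions
    {V : Type} [Fintype V] [DecidableEq V] (G : SimpleGraph V) [DecidableRel G.Adj]
    (hd : ∀ v : V, 0 < G.degree v)
    {k : ℕ} (hkn : k < Fintype.card V)
    (f : Fin (Fintype.card V) → V → ℝ) (lam : Fin (Fintype.card V) → ℝ)
    (hf : EigenData G f lam)
    (P : Fin k → Finset V) (hP : AchievesRhoAvr G P)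
    (δ ε : ℝ) (hδ0 : 0 < δ) (hδ1 : δ ≤ 1 / 2) (hε0 : 0 < ε) (hε1 : ε < 1 / 2)
    (hPsi : Psi G lam P hkn = (20 : ℝ) ^ 4 * (k : ℝ) ^ 3 / δ)
    (A : Fin k → Finset V)
    (hAdisj : ∀ i j, i ≠ j → Disjoint (A i) (A j))
    (hAcover : ∀ v : V, ∃ i, v ∈ A i)
    (c : Fin k → Fin k → ℝ)
    (hperm : ∀ π : Equiv.Perm (Fin k), ∃ i : Fin k,
      (vol G (symmDiff (A i) (P (π i))) : ℝ) ≥ 2 * ε * (vol G (P (π i)) : ℝ)) :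
    kmCost G f hkn.le A c ≥ ε / 16 - 2 * (k : ℝ) ^ 2 / Psi G lam P hkn := by
  obtain ⟨⟨hPne, hPdisj, hPcover⟩, -, -⟩ := hP
  have hk : 0 < k := ((hperm 1).choose).pos
  have hvol : ∀ i, 0 < vol G (P i) := fun i => sum_pos (fun v _ => hd v) (hPne i)
  obtain ⟨τ, hτ⟩ := exists_label P hPdisj hPcover
  obtain ⟨θ, hθ⟩ := exists_label A hAdisj hAcover
  set Ψ := Psi G lam P hkn with hΨ
  have hk1 : (1 : ℝ) ≤ k := by exact_mod_cast hk
  have hk3 : (k : ℝ) ≤ (k : ℝ) ^ 3 := le_self_pow₀ hk1 (by norm_num)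
  have hΨpos : 0 < Ψ := by rw [hPsi]; positivity
  have hΨk : 4 * (k : ℝ) ≤ Ψ := by
    rw [hPsi, le_div_iff₀ hδ0]
    nlinarith
  set T := ∑ i, ∑ j with ¬ j.val < k, alpha G P f i j ^ 2 with hT
  have hTle : T ≤ k / Ψ := by
    have havg : 0 ≤ avgCond G P := by
      simp only [avgCond, conductance]
      positivity
    have hlam0 := hf.lam_nonneg_s17 hd ⟨k, hkn⟩
    have hlam : 0 < lam ⟨k, hkn⟩ := by
      refine hlam0.lt_of_ne' fun h => hΨpos.ne' ?_
      rw [hΨ, Psi, h, zero_div]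
    have hsum : lam ⟨k, hkn⟩ * T ≤ k * avgCond G P := by
      rw [hT, mul_sum, avgCond, mul_div_cancel₀ _ (by positivity)]
      refine sum_le_sum fun i _ => ?_
      rw [← dotV_gbar_normLap hd P i (hvol i)]
      exact hf.lam_mul_tail_le hd hkn _
    rw [hΨ, Psi, div_div_eq_mul_div, le_div_iff₀ hlam]
    linarith
  have hquarter : (k : ℝ) / Ψ ≤ 1 / 4 := by
    rw [div_le_iff₀ hΨpos]
    linarith
  set p : Fin k → Fin k → ℝ := fun i j =>
    alpha G P f i (Fin.castLE hkn.le j) / Real.sqrt (vol G (P i)) with hp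
  have hclose : ∑ u, (G.degree u : ℝ) * ∑ j, (Femb G f hkn.le u j - p (τ u) j) ^ 2 = T :=
    sum_embedding_sub_center_sq hd hf hkn.le P hvol hτ
  have hfar : ε / 8 ≤ ∑ u, (G.degree u : ℝ) * ∑ j, (p (τ u) j - c (θ u) j) ^ 2 := by
    refine cost_ge_of_separated _ (fun u => Nat.cast_nonneg _) τ θ (fun i => (vol G (P i) : ℝ))
      (fun i => by exact_mod_cast hvol i) (fun i => ?_) p c (fun a b hab => ?_) hε1 fun π => ?_
    · rw [vol, Nat.cast_sum, hτ]
    · refine le_trans (mul_le_mul_of_nonneg_right ?_ (by positivity))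
        (center_separation hf hkn.le P hvol hab (hPdisj a b hab))
      linarith
    · obtain ⟨i, hi⟩ := hperm π
      refine ⟨i, hi.le.trans ?_⟩
      rw [vol, Nat.cast_sum, hτ, hθ]
  have hcost : kmCost G f hkn.le A c =
      ∑ u, (G.degree u : ℝ) * ∑ j, (Femb G f hkn.le u j - c (θ u) j) ^ 2 := by
    rw [kmCost, ← sum_fiberwise univ θ, hθ]
    exact sum_congr rfl fun i _ => sum_congr rfl fun u hu => by rw [(mem_filter.mp hu).2]
  have htri : ∑ u, (G.degree u : ℝ) * ∑ j, (p (τ u) j - c (θ u) j) ^ 2 ≤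
      2 * T + 2 * kmCost G f hkn.le A c := by
    rw [hcost, ← hclose, mul_sum, mul_sum, ← sum_add_distrib]
    refine sum_le_sum fun u _ => ?_
    rw [mul_left_comm, mul_left_comm 2, ← mul_add]
    refine mul_le_mul_of_nonneg_left ?_ (Nat.cast_nonneg _)
    rw [mul_sum, mul_sum, ← sum_add_distrib]
    refine sum_le_sum fun j _ => ?_
    nlinarith [sq_nonneg ((Femb G f hkn.le u j - p (τ u) j) + (Femb G f hkn.le u j - c (θ u) j))]
  have hkk : (k : ℝ) / Ψ ≤ 2 * (k : ℝ) ^ 2 / Ψ := by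
    gcongr
    nlinarith
  linarith

end SpectralClustering
end
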